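/- Let u be the unique solution of the exterior problem, and let P = |Du|²/u^{2(n−1)/(n−2)} be its P-function. Then for every 0 < c ≤ 1, the supremum of P over the set {u ≤ c} is attained on the level set {u = c}: sup_{{u ≤ c}} P = max_{{u = c}} P. -/

import Mathlib

open MeasureTheory Metric Set Filter
open scoped Topology ENNReal NNReal InnerProductSpace

noncomputable section

/-- Hessian of `u` at `x`, evaluated on the pair of vectors `(v, w)`. -/
def hess2 {n : ℕ} (u : EuclideanSpace ℝ (Fin n) → ℝ) (x v w : EuclideanSpace ℝ (Fin n)) : ℝ :=
  iteratedFDeriv ℝ 2 u x ![v, w]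

/-- Laplacian of `u` at `x`. -/
def lap {n : ℕ} (u : EuclideanSpace ℝ (Fin n) → ℝ) (x : EuclideanSpace ℝ (Fin n)) : ℝ :=
  ∑ i : Fin n, hess2 u x (EuclideanSpace.single i 1) (EuclideanSpace.single i 1)

/-- Mean curvature at `x` of the level set of `u` through `x`, with respect to the unit
normal `ν = -Du/|Du|`:  `H = D²u(ν,ν)/|Du|` (valid for harmonic `u`). -/
def meanH {n : ℕ} (u : EuclideanSpace ℝ (Fin n) → ℝ) (x : EuclideanSpace ℝ (Fin n)) : ℝ :=
  hess2 u x (gradient u x) (gradient u x) / ‖gradient u x‖ ^ 3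

/-- `(n-1)`-dimensional Hausdorff measure (area) of a subset of `ℝⁿ`. -/
def sArea {n : ℕ} (s : Set (EuclideanSpace ℝ (Fin n))) : ℝ :=
  (μH[(n : ℝ) - 1] s).toReal

/-- Area of the unit sphere `𝕊^{n-1} ⊆ ℝⁿ`. -/
def sphereArea (n : ℕ) : ℝ := sArea (Metric.sphere (0 : EuclideanSpace ℝ (Fin n)) 1)

/-- `Ω` is a bounded domain containing the origin. -/
def GoodDomain {n : ℕ} (Ω : Set (EuclideanSpace ℝ (Fin n))) : Prop :=
  IsOpen Ω ∧ IsConnected Ω ∧ Bornology.IsBounded Ω ∧ (0 : EuclideanSpace ℝ (Fin n)) ∈ Ω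

/-- The exterior problem: `u` is smooth up to the boundary on `ℝⁿ∖Ω`, harmonic in
`ℝⁿ∖closure(Ω)`, equal to `1` on `∂Ω`, and tends to `0` at infinity. -/
def ExteriorSol {n : ℕ} (Ω : Set (EuclideanSpace ℝ (Fin n)))
    (u : EuclideanSpace ℝ (Fin n) → ℝ) : Prop :=
  (∃ U, IsOpen U ∧ Ωᶜ ⊆ U ∧ ContDiffOn ℝ (⊤ : ℕ∞) u U) ∧
  (∀ x ∈ (closure Ω)ᶜ, lap u x = 0) ∧
  (∀ x ∈ frontier Ω, u x = 1) ∧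
  Tendsto u (cocompact (EuclideanSpace ℝ (Fin n))) (nhds 0)

/-- The interior problem with parameters `d > 0` and `c`: `u` is smooth up to the boundary away
from the origin, harmonic in `Ω∖{0}`, equal to `c` on `∂Ω`, and
`u - d|∂Ω||x|^{2-n}/((n-2)|𝕊^{n-1}|)` extends to a harmonic function on `Ω`. -/
def InteriorSol {n : ℕ} (Ω : Set (EuclideanSpace ℝ (Fin n))) (d c : ℝ)
    (u : EuclideanSpace ℝ (Fin n) → ℝ) : Prop :=
  (∃ U, IsOpen U ∧ closure Ω ⊆ U ∧ ContDiffOn ℝ (⊤ : ℕ∞) u (U \ {0})) ∧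
  (∀ x ∈ Ω \ {(0 : EuclideanSpace ℝ (Fin n))}, lap u x = 0) ∧
  (∀ x ∈ frontier Ω, u x = c) ∧
  (∃ v : EuclideanSpace ℝ (Fin n) → ℝ, ContDiffOn ℝ (⊤ : ℕ∞) v Ω ∧ (∀ x ∈ Ω, lap v x = 0) ∧
    ∀ x ∈ Ω \ {(0 : EuclideanSpace ℝ (Fin n))},
      u x = d * sArea (frontier Ω) / (((n : ℝ) - 2) * sphereArea n) * ‖x‖ ^ ((2 : ℝ) - n) + v x)

/-- The `P`-function `|Du|²/u^{2(n-1)/(n-2)} = |∇f|_g²`. -/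
def Pfun {n : ℕ} (u : EuclideanSpace ℝ (Fin n) → ℝ) (x : EuclideanSpace ℝ (Fin n)) : ℝ :=
  ‖gradient u x‖ ^ 2 / u x ^ (2 * ((n : ℝ) - 1) / ((n : ℝ) - 2))

/-- `|∇f|_g = |Du|/u^{(n-1)/(n-2)}`, the `g`-length of the gradient of `f = log u`. -/
def gradg {n : ℕ} (u : EuclideanSpace ℝ (Fin n) → ℝ) (x : EuclideanSpace ℝ (Fin n)) : ℝ :=
  ‖gradient u x‖ / u x ^ (((n : ℝ) - 1) / ((n : ℝ) - 2))

/-- The tensor `T = D²f - (1/(n-2))(2 df⊗df - |Df|² Id)` for `f = log u`, evaluated on `(v,w)`. -/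
def Tlog {n : ℕ} (u : EuclideanSpace ℝ (Fin n) → ℝ) (x v w : EuclideanSpace ℝ (Fin n)) : ℝ :=
  hess2 (fun y => Real.log (u y)) x v w -
    (1 / ((n : ℝ) - 2)) *
      (2 * ⟪gradient (fun y => Real.log (u y)) x, v⟫_ℝ *
          ⟪gradient (fun y => Real.log (u y)) x, w⟫_ℝ -
        ‖gradient (fun y => Real.log (u y)) x‖ ^ 2 * ⟪v, w⟫_ℝ)

/-- `|∇²f|_g² = u^{-4/(n-2)} |T|²`, the squared `g`-norm of the `g`-Hessian of `f = log u`. -/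
def hessgSq {n : ℕ} (u : EuclideanSpace ℝ (Fin n) → ℝ) (x : EuclideanSpace ℝ (Fin n)) : ℝ :=
  u x ^ (-(4 : ℝ) / ((n : ℝ) - 2)) *
    ∑ i : Fin n, ∑ j : Fin n,
      (Tlog u x (EuclideanSpace.single i 1) (EuclideanSpace.single j 1)) ^ 2

/-- The `g`-mean curvature of a regular level set of `u`:
`H_g/(n-1) = u^{-1/(n-2)} ( H/(n-1) - |Du|/((n-2)u) )`. -/
def Hg {n : ℕ} (u : EuclideanSpace ℝ (Fin n) → ℝ) (x : EuclideanSpace ℝ (Fin n)) : ℝ :=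
  ((n : ℝ) - 1) * u x ^ (-(1 : ℝ) / ((n : ℝ) - 2)) *
    (meanH u x / ((n : ℝ) - 1) - ‖gradient u x‖ / (((n : ℝ) - 2) * u x))

/-- The pointwise Hessian identity `u·D²u = (n/(n-2)) Du⊗Du - (|Du|²/(n-2)) Id`, equivalent to
the vanishing of the `g`-Hessian of `f = log u`. -/
def HessId {n : ℕ} (u : EuclideanSpace ℝ (Fin n) → ℝ) (x : EuclideanSpace ℝ (Fin n)) : Prop :=
  ∀ v w : EuclideanSpace ℝ (Fin n),
    u x * hess2 u x v w =
      ((n : ℝ) / ((n : ℝ) - 2)) * (⟪gradient u x, v⟫_ℝ * ⟪gradient u x, w⟫_ℝ) -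
        (‖gradient u x‖ ^ 2 / ((n : ℝ) - 2)) * ⟪v, w⟫_ℝ

/-- The partial derivative of `f` in the `i`-th coordinate direction. -/
def pderiv {n : ℕ} (i : Fin n) (f : EuclideanSpace ℝ (Fin n) → ℝ)
    (x : EuclideanSpace ℝ (Fin n)) : ℝ :=
  fderiv ℝ f x (EuclideanSpace.single i 1)

section Calculus

variable {n : ℕ} {f g : EuclideanSpace ℝ (Fin n) → ℝ} {x : EuclideanSpace ℝ (Fin n)}

lemma ContDiffAt.pderiv {k m : WithTop ℕ∞} (hf : ContDiffAt ℝ k f x) (hkm : m + 1 ≤ k)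
    (i : Fin n) : ContDiffAt ℝ m (pderiv i f) x :=
  (hf.fderiv_right hkm).clm_apply contDiffAt_const

lemma pderiv_congr (h : f =ᶠ[𝓝 x] g) (i : Fin n) : pderiv i f x = pderiv i g x := by
  simp only [pderiv, h.fderiv_eq]

lemma pderiv_add (hf : DifferentiableAt ℝ f x) (hg : DifferentiableAt ℝ g x) (i : Fin n) :
    pderiv i (fun y => f y + g y) x = pderiv i f x + pderiv i g x := by
  simp [pderiv, fderiv_fun_add hf hg]

lemma pderiv_mul (hf : DifferentiableAt ℝ f x) (hg : DifferentiableAt ℝ g x) (i : Fin n) :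
    pderiv i (fun y => f y * g y) x = pderiv i f x * g x + f x * pderiv i g x := by
  simp [pderiv, fderiv_fun_mul hf hg]
  ring

lemma pderiv_sum {ι : Type*} {s : Finset ι} {F : ι → EuclideanSpace ℝ (Fin n) → ℝ}
    (hF : ∀ j ∈ s, DifferentiableAt ℝ (F j) x) (i : Fin n) :
    pderiv i (fun y => ∑ j ∈ s, F j y) x = ∑ j ∈ s, pderiv i (F j) x := by
  simp [pderiv, fderiv_fun_sum hF]

lemma pderiv_const (c : ℝ) (i : Fin n) : pderiv i (fun _ => c) x = 0 := by
  simp [pderiv]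

lemma pderiv_comp {φ : ℝ → ℝ} {a : ℝ} (hφ : HasDerivAt φ a (f x)) (hf : DifferentiableAt ℝ f x)
    (i : Fin n) : pderiv i (fun y => φ (f y)) x = a * pderiv i f x := by
  have h := (hφ.comp_hasFDerivAt x hf.hasFDerivAt).fderiv
  simp only [pderiv]
  rw [show (fun y => φ (f y)) = φ ∘ f from rfl, h]
  simp

lemma pderiv_comm (hf : ContDiffAt ℝ 2 f x) (i j : Fin n) :
    pderiv i (pderiv j f) x = pderiv j (pderiv i f) x := by
  have hd : DifferentiableAt ℝ (fderiv ℝ f) x :=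
    (hf.fderiv_right (m := 1) (by norm_num)).differentiableAt (by norm_num)
  have key : ∀ v w, fderiv ℝ (fun y => fderiv ℝ f y v) x w = fderiv ℝ (fderiv ℝ f) x w v := by
    intro v w
    rw [fderiv_clm_apply hd (differentiableAt_const _)]
    simp
  have hs := hf.isSymmSndFDerivAt (by simp)
  change fderiv ℝ (fun y => fderiv ℝ f y _) x _ = fderiv ℝ (fun y => fderiv ℝ f y _) x _
  rw [key, key, hs.eq]

lemma lap_eq_sum_pderiv (hf : ContDiffAt ℝ 2 f x) :
    lap f x = ∑ i, pderiv i (pderiv i f) x := by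
  have hd : DifferentiableAt ℝ (fderiv ℝ f) x :=
    (hf.fderiv_right (m := 1) (by norm_num)).differentiableAt (by norm_num)
  refine Finset.sum_congr rfl fun i _ => ?_
  simp only [hess2, iteratedFDeriv_two_apply]
  change _ = fderiv ℝ (fun y => fderiv ℝ f y _) x _
  rw [fderiv_clm_apply hd (differentiableAt_const _)]
  simp

lemma lap_add (hf : ContDiffAt ℝ 2 f x) (hg : ContDiffAt ℝ 2 g x) :
    lap (fun y => f y + g y) x = lap f x + lap g x := by
  simp only [lap, hess2, ← Finset.sum_add_distrib]
  exact Finset.sum_congr rfl fun i _ => by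
    rw [fun_iteratedFDeriv_add_apply (i := 2) hf hg, add_apply]

lemma lap_sum {ι : Type*} {s : Finset ι} {F : ι → EuclideanSpace ℝ (Fin n) → ℝ}
    (hF : ∀ j ∈ s, ContDiffAt ℝ 2 (F j) x) :
    lap (fun y => ∑ j ∈ s, F j y) x = ∑ j ∈ s, lap (F j) x := by
  classical
  induction s using Finset.induction_on with
  | empty => simp [lap, hess2, iteratedFDeriv_two_apply]
  | insert a s ha ih =>
    simp only [Finset.sum_insert ha]
    rw [lap_add (hF a (by simp)), ih fun j hj => hF j (by simp [hj])]
    exact ContDiffAt.sum fun j hj => hF j (by simp [hj])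

lemma lap_const (c : ℝ) : lap (fun _ => c) x = 0 := by
  simp [lap, hess2, iteratedFDeriv_two_apply]

lemma ContDiffAt.eventually_differentiableAt (hf : ContDiffAt ℝ 2 f x) :
    ∀ᶠ y in 𝓝 x, DifferentiableAt ℝ f y := by
  filter_upwards [hf.eventually (by simp)] with y hy using hy.differentiableAt (by norm_num)

lemma ContDiffAt.differentiableAt_pderiv (hf : ContDiffAt ℝ 2 f x) (i : Fin n) :
    DifferentiableAt ℝ (_root_.pderiv i f) x :=
  (hf.pderiv (m := 1) (by norm_num) i).differentiableAt (by norm_num)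

lemma lap_mul (hf : ContDiffAt ℝ 2 f x) (hg : ContDiffAt ℝ 2 g x) :
    lap (fun y => f y * g y) x =
      lap f x * g x + 2 * ∑ i, pderiv i f x * pderiv i g x + f x * lap g x := by
  rw [lap_eq_sum_pderiv (hf.mul hg), lap_eq_sum_pderiv hf, lap_eq_sum_pderiv hg, Finset.sum_mul,
    Finset.mul_sum, Finset.mul_sum, ← Finset.sum_add_distrib, ← Finset.sum_add_distrib]
  refine Finset.sum_congr rfl fun i _ => ?_
  have h : pderiv i (fun y => f y * g y) =ᶠ[𝓝 x]
      fun y => pderiv i f y * g y + f y * pderiv i g y := by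
    filter_upwards [hf.eventually_differentiableAt, hg.eventually_differentiableAt] with y h1 h2
      using pderiv_mul h1 h2 i
  have f1 := hf.differentiableAt (by norm_num)
  have g1 := hg.differentiableAt (by norm_num)
  have f2 := hf.differentiableAt_pderiv i
  have g2 := hg.differentiableAt_pderiv i
  rw [pderiv_congr h, pderiv_add (f2.fun_mul g1) (f1.fun_mul g2), pderiv_mul f2 g1, pderiv_mul f1 g2]
  ring

lemma lap_const_mul (c : ℝ) (hf : ContDiffAt ℝ 2 f x) :
    lap (fun y => c * f y) x = c * lap f x := by
  rw [lap_mul contDiffAt_const hf, lap_const]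
  simp [pderiv_const]

lemma pderiv_rpow (hf : DifferentiableAt ℝ f x) (h0 : 0 < f x) (p : ℝ) (i : Fin n) :
    pderiv i (fun y => f y ^ p) x = p * f x ^ (p - 1) * pderiv i f x :=
  pderiv_comp (φ := fun s => s ^ p) (Real.hasDerivAt_rpow_const (Or.inl h0.ne')) hf i

lemma lap_rpow (hf : ContDiffAt ℝ 2 f x) (h0 : 0 < f x) (p : ℝ) :
    lap (fun y => f y ^ p) x =
      p * (p - 1) * f x ^ (p - 2) * ∑ i, pderiv i f x ^ 2 + p * f x ^ (p - 1) * lap f x := by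
  rw [lap_eq_sum_pderiv (hf.rpow_const_of_ne h0.ne'), lap_eq_sum_pderiv hf, Finset.mul_sum,
    Finset.mul_sum, ← Finset.sum_add_distrib]
  refine Finset.sum_congr rfl fun i _ => ?_
  have h : pderiv i (fun y => f y ^ p) =ᶠ[𝓝 x] fun y => p * f y ^ (p - 1) * pderiv i f y := by
    filter_upwards [hf.eventually_differentiableAt,
      hf.continuousAt.eventually (lt_mem_nhds h0)] with y h1 h2 using pderiv_rpow h1 h2 p i
  have f1 := hf.differentiableAt (by norm_num)
  have f3 : DifferentiableAt ℝ (fun y => f y ^ (p - 1)) x := f1.rpow_const (Or.inl h0.ne')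
  rw [pderiv_congr h, pderiv_mul (f3.const_mul p) (hf.differentiableAt_pderiv i),
    pderiv_mul (differentiableAt_const p) f3, pderiv_const, pderiv_rpow f1 h0,
    show p - 1 - 1 = p - 2 by ring]
  ring

lemma norm_gradient_sq (f : EuclideanSpace ℝ (Fin n) → ℝ) (x : EuclideanSpace ℝ (Fin n)) :
    ‖gradient f x‖ ^ 2 = ∑ i, pderiv i f x ^ 2 := by
  rw [EuclideanSpace.norm_sq_eq]
  refine Finset.sum_congr rfl fun i _ => ?_
  have h : pderiv i f x = gradient f x i := by
    rw [pderiv, ← inner_gradient_left, EuclideanSpace.inner_single_right]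
    simp
  rw [h, Real.norm_eq_abs, sq_abs]

lemma pderiv_norm_sub_sq (a : EuclideanSpace ℝ (Fin n)) (i : Fin n) :
    pderiv i (fun y => ‖y - a‖ ^ 2) x = 2 * (x i - a i) := by
  have h := ((hasFDerivAt_id x).sub_const a).norm_sq.fderiv
  simp only [id] at h
  rw [pderiv, h]
  simp [EuclideanSpace.inner_single_right]

lemma contDiff_norm_sub_sq (a : EuclideanSpace ℝ (Fin n)) (k : WithTop ℕ∞) :
    ContDiff ℝ k (fun y => ‖y - a‖ ^ 2) :=
  (contDiff_id.sub contDiff_const).norm_sq ℝ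

lemma lap_norm_sub_sq (a : EuclideanSpace ℝ (Fin n)) :
    lap (fun y => ‖y - a‖ ^ 2) x = 2 * n := by
  rw [lap_eq_sum_pderiv (contDiff_norm_sub_sq a 2).contDiffAt]
  have h : ∀ i : Fin n, pderiv i (pderiv i fun y => ‖y - a‖ ^ 2) x = 2 := by
    intro i
    rw [show (pderiv i fun y => ‖y - a‖ ^ 2) = fun y => 2 * (y i - a i) from
      funext fun y => pderiv_norm_sub_sq a i]
    have : HasFDerivAt (fun y : EuclideanSpace ℝ (Fin n) => 2 * (y i - a i))
        ((2 : ℝ) • (EuclideanSpace.proj i : EuclideanSpace ℝ (Fin n) →L[ℝ] ℝ)) x :=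
      ((EuclideanSpace.proj i : EuclideanSpace ℝ (Fin n) →L[ℝ] ℝ).hasFDerivAt.sub_const
        (a i)).const_mul 2
    rw [pderiv, this.fderiv]
    simp
  simp [h, mul_comm]

end Calculus

section Bochner

variable {n : ℕ} {u : EuclideanSpace ℝ (Fin n) → ℝ} {x : EuclideanSpace ℝ (Fin n)}

lemma ContDiffAt.eventually_pderiv_comm (hu : ContDiffAt ℝ 3 u x) (i j : Fin n) :
    _root_.pderiv i (_root_.pderiv j u) =ᶠ[𝓝 x] _root_.pderiv j (_root_.pderiv i u) := by
  filter_upwards [hu.eventually (by simp)] with y hy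
  exact pderiv_comm (hy.of_le (by norm_num)) i j

lemma sum_pderiv_pderiv_eq_zero (hu : ContDiffAt ℝ 2 u x) (hlap : lap u x = 0) :
    ∑ i, pderiv i (pderiv i u) x = 0 := by
  rw [← lap_eq_sum_pderiv hu, hlap]

lemma lap_pderiv_eq_zero (hu : ContDiffAt ℝ 3 u x) (hlap : ∀ᶠ y in 𝓝 x, lap u y = 0)
    (j : Fin n) : lap (pderiv j u) x = 0 := by
  have h2 : ∀ i, ContDiffAt ℝ 2 (pderiv i u) x := fun i => hu.pderiv (by norm_num) i
  rw [lap_eq_sum_pderiv (h2 j)]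
  have h : ∀ i, pderiv i (pderiv i (pderiv j u)) x = pderiv j (pderiv i (pderiv i u)) x := by
    intro i
    rw [pderiv_congr (hu.eventually_pderiv_comm i j), pderiv_comm (h2 i)]
  simp only [h]
  rw [← pderiv_sum fun i _ => (h2 i).differentiableAt_pderiv i,
    pderiv_congr (g := fun _ => 0), pderiv_const]
  filter_upwards [hlap, hu.eventually (by simp)] with y h0 h3
  exact sum_pderiv_pderiv_eq_zero (h3.of_le (by norm_num)) h0

lemma contDiffAt_sum_pderiv_sq (hu : ContDiffAt ℝ 3 u x) :
    ContDiffAt ℝ 2 (fun y => ∑ j, pderiv j u y ^ 2) x :=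
  ContDiffAt.sum fun j _ => (hu.pderiv (by norm_num) j).pow 2

lemma pderiv_sum_pderiv_sq (hu : ContDiffAt ℝ 2 u x) (i : Fin n) :
    pderiv i (fun y => ∑ j, pderiv j u y ^ 2) x =
      2 * ∑ j, pderiv i (pderiv j u) x * pderiv j u x := by
  have h1 : ∀ j, DifferentiableAt ℝ (pderiv j u) x := fun j => hu.differentiableAt_pderiv j
  rw [pderiv_sum fun j _ => (h1 j).fun_pow 2, Finset.mul_sum]
  refine Finset.sum_congr rfl fun j _ => ?_
  simp only [sq]
  rw [pderiv_mul (h1 j) (h1 j)]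
  ring

/-- Bochner's formula for harmonic functions. -/
lemma lap_sum_pderiv_sq (hu : ContDiffAt ℝ 3 u x) (hlap : ∀ᶠ y in 𝓝 x, lap u y = 0) :
    lap (fun y => ∑ j, pderiv j u y ^ 2) x =
      2 * ∑ i, ∑ j, pderiv i (pderiv j u) x ^ 2 := by
  have h2 : ∀ i, ContDiffAt ℝ 2 (pderiv i u) x := fun i => hu.pderiv (by norm_num) i
  rw [lap_sum fun j _ => (h2 j).pow 2, Finset.sum_comm, Finset.mul_sum]
  refine Finset.sum_congr rfl fun j _ => ?_
  simp only [sq]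
  rw [lap_mul (h2 j) (h2 j), lap_pderiv_eq_zero hu hlap]
  ring

lemma hessian_quadratic_nonneg (hn : 3 ≤ n) (a : Fin n → Fin n → ℝ) (d : Fin n → ℝ)
    (htr : ∑ i, a i i = 0) :
    0 ≤ 2 * ∑ i, ∑ j, a i j ^ 2 - 4 * ((n : ℝ) / (n - 2)) * ∑ i, ∑ j, a i j * d i * d j +
      (n : ℝ) / (n - 2) * ((n : ℝ) / (n - 2) + 1) * (∑ i, d i ^ 2) ^ 2 := by
  have hn2 : (n : ℝ) - 2 ≠ 0 := by
    have : (3 : ℝ) ≤ n := by exact_mod_cast hn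
    linarith
  set p : ℝ := (n : ℝ) / (n - 2) with hp
  set q : ℝ := (∑ i, d i ^ 2) / (n - 2) with hq
  have h0 : 0 ≤ ∑ i, ∑ j, (a i j - p * d i * d j + if i = j then q else 0) ^ 2 :=
    Finset.sum_nonneg fun i _ => Finset.sum_nonneg fun j _ => sq_nonneg _
  have h1 : ∀ i j, (a i j - p * d i * d j + if i = j then q else 0) ^ 2 =
      a i j ^ 2 - 2 * p * (a i j * d i * d j) + p ^ 2 * (d i ^ 2 * d j ^ 2) +
        if i = j then q ^ 2 + 2 * q * a i j - 2 * p * q * (d i * d j) else 0 := by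
    intro i j
    split_ifs <;> ring
  have h3 : ∑ i, d i ^ 2 = q * (n - 2) := by rw [hq]; field_simp
  have h4 : ∑ i, d i * d i = q * (n - 2) := by simpa [sq] using h3
  simp only [h1, Finset.sum_add_distrib, Finset.sum_sub_distrib, ← Finset.mul_sum,
    Finset.sum_ite_eq, Finset.mem_univ, if_true, ← Finset.sum_mul, htr, h3, h4,
    Finset.sum_const, Finset.card_univ, Fintype.card_fin, nsmul_eq_mul] at h0 ⊢
  have h5 : p * (n - 2) = n := by rw [hp]; field_simp
  have h6 : p * (p + 1) * (q * (n - 2)) ^ 2 =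
      2 * (p ^ 2 * (q * (n - 2) * (q * (n - 2))) + (n * q ^ 2 - 2 * p * q * (q * (n - 2)))) := by
    rw [hp]; field_simp; ring
  linarith

/-- For a positive harmonic `u`, the function `|Du|² u^{-n/(n-2)}` is subharmonic. -/
lemma lap_sum_pderiv_sq_mul_rpow_nonneg (hn : 3 ≤ n) (hu : ContDiffAt ℝ 3 u x)
    (hlap : ∀ᶠ y in 𝓝 x, lap u y = 0) (hpos : 0 < u x) :
    0 ≤ lap (fun y => (∑ j, pderiv j u y ^ 2) * u y ^ (-((n : ℝ) / (n - 2)))) x := by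
  have hu2 : ContDiffAt ℝ 2 u x := hu.of_le (by norm_num)
  set p : ℝ := (n : ℝ) / (n - 2) with hp
  rw [lap_mul (contDiffAt_sum_pderiv_sq hu) (hu2.rpow_const_of_ne hpos.ne'),
    lap_sum_pderiv_sq hu hlap, lap_rpow hu2 hpos, hlap.self_of_nhds]
  simp only [pderiv_sum_pderiv_sq hu2,
    pderiv_rpow (hu2.differentiableAt (by norm_num)) hpos]
  set s := u x ^ (-p - 2) with hs
  have e1 : u x ^ (-p - 1) = s * u x := by
    rw [hs, ← Real.rpow_add_one hpos.ne']; ring_nf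
  have e0 : u x ^ (-p) = s * u x ^ 2 := by
    rw [hs, ← Real.rpow_add_natCast hpos.ne']; norm_num
  rw [e0, e1]
  have key := hessian_quadratic_nonneg hn (fun i j => u x * pderiv i (pderiv j u) x)
    (fun i => pderiv i u x)
    (by rw [← Finset.mul_sum, sum_pderiv_pderiv_eq_zero hu2 hlap.self_of_nhds, mul_zero])
  have k := mul_nonneg (Real.rpow_pos_of_pos hpos (-p - 2)).le key
  rw [← hs, ← hp] at k
  refine k.trans_eq ?_
  have t1 : ∑ i, 2 * (∑ j, pderiv i (pderiv j u) x * pderiv j u x) *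
      (-p * (s * u x) * pderiv i u x) = (-2 * p * s) *
        ∑ i, ∑ j, u x * pderiv i (pderiv j u) x * pderiv i u x * pderiv j u x := by
    rw [Finset.mul_sum]
    refine Finset.sum_congr rfl fun i _ => ?_
    rw [Finset.mul_sum, Finset.mul_sum, Finset.sum_mul]
    exact Finset.sum_congr rfl fun j _ => by ring
  rw [t1]
  simp only [mul_pow, ← Finset.mul_sum]
  ring

end Bochner

section MaximumPrinciple

variable {n : ℕ} {f w : EuclideanSpace ℝ (Fin n) → ℝ} {x : EuclideanSpace ℝ (Fin n)}

lemma hasDerivAt_comp_line (i : Fin n) (t : ℝ)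
    (hf : DifferentiableAt ℝ f (x + t • EuclideanSpace.single i 1)) :
    HasDerivAt (fun s : ℝ => f (x + s • EuclideanSpace.single i 1))
      (pderiv i f (x + t • EuclideanSpace.single i 1)) t := by
  have h : HasDerivAt (fun s : ℝ => x + s • (EuclideanSpace.single i (1 : ℝ)))
      (EuclideanSpace.single i (1 : ℝ)) t := by
    simpa using ((hasDerivAt_id t).smul_const (EuclideanSpace.single i (1 : ℝ))).const_add x
  exact hf.hasFDerivAt.comp_hasDerivAt t h

lemma IsLocalMax.pderiv_pderiv_nonpos (h : IsLocalMax f x) (hf : ContDiffAt ℝ 2 f x)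
    (i : Fin n) : pderiv i (pderiv i f) x ≤ 0 := by
  by_contra! hpos
  let e : EuclideanSpace ℝ (Fin n) := EuclideanSpace.single i 1
  let g : ℝ → ℝ := fun t => f (x + t • e)
  have hline : Tendsto (fun t : ℝ => x + t • e) (𝓝 0) (𝓝 x) := by
    have : Continuous (fun t : ℝ => x + t • e) := by fun_prop
    simpa using this.tendsto 0
  have hg1 : deriv g =ᶠ[𝓝 0] fun t => pderiv i f (x + t • e) := by
    filter_upwards [hline.eventually hf.eventually_differentiableAt] with t ht
    exact (hasDerivAt_comp_line i t ht).deriv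
  have hg2 : deriv (deriv g) 0 = pderiv i (pderiv i f) x := by
    rw [hg1.deriv_eq]
    have := hasDerivAt_comp_line (f := pderiv i f) (x := x) i 0
      (by simpa using hf.differentiableAt_pderiv i)
    simpa using this.deriv
  have hmax : IsLocalMax g 0 := by
    filter_upwards [hline.eventually h] with t ht
    simpa [g] using ht
  have hcont : ContinuousAt g 0 := by
    refine ContinuousAt.comp (g := f) (f := fun t : ℝ => x + t • e) ?_ (by fun_prop)
    simpa using hf.continuousAt
  have hmin : IsLocalMin g 0 :=
    isLocalMin_of_deriv_deriv_pos (by rw [hg2]; exact hpos) hmax.deriv_eq_zero hcont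
  have hconst : g =ᶠ[𝓝 0] fun _ => g 0 := by
    filter_upwards [hmax, hmin] with t h1 h2 using le_antisymm h1 h2
  have hd : deriv g =ᶠ[𝓝 0] fun _ => 0 := by
    filter_upwards [hconst.eventuallyEq_nhds] with t ht
    rw [ht.deriv_eq, deriv_const]
  rw [hd.deriv_eq, deriv_const] at hg2
  exact hpos.ne hg2

lemma IsLocalMax.lap_nonpos (h : IsLocalMax f x) (hf : ContDiffAt ℝ 2 f x) : lap f x ≤ 0 := by
  rw [lap_eq_sum_pderiv hf]
  exact Finset.sum_nonpos fun i _ => h.pderiv_pderiv_nonpos hf i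

/-- The weak maximum principle for subharmonic functions on a bounded open set. -/
lemma le_of_lap_nonneg_of_isBounded (hn : 0 < n) {D : Set (EuclideanSpace ℝ (Fin n))}
    (hD : IsOpen D) (hb : Bornology.IsBounded D) (hc : ContinuousOn w (closure D))
    (hw : ∀ y ∈ D, ContDiffAt ℝ 2 w y) (hlap : ∀ y ∈ D, 0 ≤ lap w y) {M : ℝ}
    (hM : ∀ y ∈ closure D, y ∉ D → w y ≤ M) (hx : x ∈ D) : w x ≤ M := by
  by_contra! hlt
  have hK : IsCompact (closure D) := hb.isCompact_closure
  obtain ⟨B, hB⟩ := hb.closure.exists_norm_le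
  have hB0 : 0 ≤ B := (norm_nonneg x).trans (hB x (subset_closure hx))
  obtain ⟨ε, hε, hεB⟩ : ∃ ε > 0, M + ε * B ^ 2 < w x := by
    refine ⟨(w x - M) / (2 * (B ^ 2 + 1)), by have := sub_pos.2 hlt; positivity, ?_⟩
    have h1 : (w x - M) / (2 * (B ^ 2 + 1)) * B ^ 2 < w x - M := by
      rw [div_mul_eq_mul_div, div_lt_iff₀ (by positivity)]
      nlinarith [sub_pos.2 hlt, sq_nonneg B, mul_nonneg (sub_pos.2 hlt).le (sq_nonneg B)]
    linarith
  let q : EuclideanSpace ℝ (Fin n) → ℝ := fun y => ‖y - 0‖ ^ 2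
  have hq : ContDiff ℝ 2 q := contDiff_norm_sub_sq 0 2
  let v : EuclideanSpace ℝ (Fin n) → ℝ := fun y => w y + ε * q y
  obtain ⟨z, hz, hzmax⟩ := hK.exists_isMaxOn ⟨x, subset_closure hx⟩
    (hc.add (continuousOn_const.mul hq.continuous.continuousOn) : ContinuousOn v (closure D))
  have hxz : w x ≤ v z := by
    refine le_trans ?_ (hzmax (subset_closure hx))
    have : 0 ≤ ε * q x := by positivity
    simpa [v] using this
  have hzD : z ∈ D := by
    by_contra hzD
    have h1 := hM z hz hzD
    have h2 : q z ≤ B ^ 2 := by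
      simpa [q] using pow_le_pow_left₀ (norm_nonneg z) (hB z hz) 2
    have h3 : ε * q z ≤ ε * B ^ 2 := by gcongr
    simp only [v] at hxz
    linarith
  have hloc : IsLocalMax v z := by
    filter_upwards [hD.mem_nhds hzD] with y hy using hzmax (subset_closure hy)
  have hwz := hw z hzD
  have hle := hloc.lap_nonpos (hwz.add (contDiffAt_const.mul hq.contDiffAt))
  simp only [v] at hle
  rw [lap_add hwz (contDiffAt_const.mul hq.contDiffAt), lap_const_mul _ hq.contDiffAt,
    lap_norm_sub_sq] at hle
  have h1 := hlap z hzD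
  have h2 : 0 < ε * (2 * (n : ℝ)) := by positivity
  linarith

/-- The weak maximum principle for subharmonic functions on an open set, with an upper bound at
infinity. -/
lemma nonpos_of_lap_nonneg (hn : 0 < n) {D : Set (EuclideanSpace ℝ (Fin n))}
    (hD : IsOpen D) (hc : ContinuousOn w (closure D))
    (hw : ∀ y ∈ D, ContDiffAt ℝ 2 w y) (hlap : ∀ y ∈ D, 0 ≤ lap w y)
    (hbd : ∀ y ∈ closure D, y ∉ D → w y ≤ 0)
    (hinf : ∀ δ > 0, ∀ᶠ y in cocompact (EuclideanSpace ℝ (Fin n)), y ∈ closure D → w y ≤ δ)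
    (hx : x ∈ D) : w x ≤ 0 := by
  refine le_of_forall_pos_le_add fun δ hδ => ?_
  rw [zero_add]
  obtain ⟨R, hR'⟩ : ∃ R : ℝ, ∀ y, R ≤ ‖y‖ → y ∈ closure D → w y ≤ δ := by
    have h := hinf δ hδ
    rw [← cobounded_eq_cocompact] at h
    obtain ⟨R, -, hR⟩ := hasBasis_cobounded_norm.eventually_iff.1 h
    exact ⟨R, fun y hy => hR hy⟩
  have hR : ∀ y ∈ closure D, R ≤ ‖y‖ → w y ≤ δ := fun y hy hyR => hR' y hyR hy
  by_cases hxR : R ≤ ‖x‖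
  · exact hR x (subset_closure hx) hxR
  have hsub : closure (D ∩ ball 0 R) ⊆ closure D := closure_mono inter_subset_left
  refine le_of_lap_nonneg_of_isBounded hn (hD.inter isOpen_ball)
    (isBounded_ball.subset inter_subset_right) (hc.mono hsub) (fun y hy => hw y hy.1)
    (fun y hy => hlap y hy.1) (fun y hy hyn => ?_) ⟨hx, by simpa using hxR⟩
  by_cases hyD : y ∈ D
  · refine hR y (hsub hy) ?_
    by_contra! h
    exact hyn ⟨hyD, by simpa using h⟩
  · exact (hbd y (hsub hy) hyD).trans hδ.le

/-- Bernstein's interior gradient estimate for harmonic functions. -/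
lemma sum_pderiv_sq_le_of_harmonic (hn : 0 < n) {a : EuclideanSpace ℝ (Fin n)} {r S : ℝ}
    (hr : 0 < r) (hu : ∀ y ∈ closedBall a r, ContDiffAt ℝ 3 f y)
    (hlap : ∀ y ∈ ball a r, lap f y = 0) (hS : ∀ y ∈ closedBall a r, f y ^ 2 ≤ S) :
    ∑ j, pderiv j f a ^ 2 ≤ (2 * n + 16) * S / r ^ 2 := by
  let η : EuclideanSpace ℝ (Fin n) → ℝ := fun y => r ^ 2 + (-1) * ‖y - a‖ ^ 2
  let G : EuclideanSpace ℝ (Fin n) → ℝ := fun y => ∑ j, pderiv j f y ^ 2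
  let c : ℝ := (2 * n + 16) * r ^ 2
  have hN : ∀ k y, ContDiffAt ℝ k (fun y => ‖y - a‖ ^ 2) y := fun k y =>
    (contDiff_norm_sub_sq a k).contDiffAt
  have hη : ∀ y, ContDiffAt ℝ 2 η y := fun y =>
    contDiffAt_const.add (contDiffAt_const.mul (hN 2 y))
  have hηd : ∀ i y, pderiv i η y = -2 * (y i - a i) := fun i y => by
    have hd := (hN 2 y).differentiableAt (by norm_num)
    simp only [η]
    rw [pderiv_add (differentiableAt_const _) (hd.const_mul _),
      pderiv_mul (differentiableAt_const _) hd, pderiv_const, pderiv_const, pderiv_norm_sub_sq]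
    ring
  have hηl : ∀ y, lap η y = -2 * n := fun y => by
    simp only [η]
    rw [lap_add contDiffAt_const (contDiffAt_const.mul (hN 2 y)), lap_const,
      lap_const_mul _ (hN 2 y), lap_norm_sub_sq]
    ring
  have hu2 : ∀ y ∈ closedBall a r, ContDiffAt ℝ 2 f y := fun y hy => (hu y hy).of_le (by norm_num)
  have hG : ∀ y ∈ closedBall a r, ContDiffAt ℝ 2 G y := fun y hy =>
    contDiffAt_sum_pderiv_sq (hu y hy)
  let w : EuclideanSpace ℝ (Fin n) → ℝ := fun y => η y * η y * G y + c * (f y * f y)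
  have hw : ∀ y ∈ closedBall a r, ContDiffAt ℝ 2 w y := fun y hy =>
    (((hη y).mul (hη y)).mul (hG y hy)).add (contDiffAt_const.mul ((hu2 y hy).mul (hu2 y hy)))
  have hcl : closure (ball a r) = closedBall a r := closure_ball a hr.ne'
  have hmax : w a ≤ c * S := by
    refine le_of_lap_nonneg_of_isBounded hn isOpen_ball isBounded_ball ?_ ?_ ?_ ?_
      (mem_ball_self hr)
    · rw [hcl]
      exact fun y hy => (hw y hy).continuousAt.continuousWithinAt
    · exact fun y hy => hw y (ball_subset_closedBall hy)
    · intro y hy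
      have hy' := ball_subset_closedBall hy
      have hev : ∀ᶠ z in 𝓝 y, lap f z = 0 := by
        filter_upwards [isOpen_ball.mem_nhds hy] with z hz using hlap z hz
      have hηη := (hη y).mul (hη y)
      have hff := (hu2 y hy').mul (hu2 y hy')
      have hηd1 := (hη y).differentiableAt (by norm_num : (2 : WithTop ℕ∞) ≠ 0)
      have hnorm : ∑ i, (y i - a i) ^ 2 < r ^ 2 := by
        have h1 : ‖y - a‖ < r := by simpa [dist_eq_norm] using hy
        have h2 := EuclideanSpace.norm_sq_eq (y - a)
        simp only [PiLp.sub_apply, Real.norm_eq_abs, sq_abs] at h2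
        rw [← h2]
        exact pow_lt_pow_left₀ h1 (norm_nonneg _) two_ne_zero
      have hη0 : η y ≤ r ^ 2 := by
        have : 0 ≤ ‖y - a‖ ^ 2 := by positivity
        simp only [η]; linarith
      have hG0 : 0 ≤ G y := Finset.sum_nonneg fun j _ => sq_nonneg _
      simp only [w]
      rw [lap_add (hηη.mul (hG y hy')) (contDiffAt_const.mul hff), lap_mul hηη (hG y hy'),
        lap_mul (hη y) (hη y), lap_const_mul _ hff, lap_mul (hu2 y hy') (hu2 y hy'),
        lap_sum_pderiv_sq (hu y hy') hev, hlap y hy, hηl]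
      simp only [pderiv_mul hηd1 hηd1, G, pderiv_sum_pderiv_sq (hu2 y hy'), hηd]
      have hGy : ∑ i, pderiv i f y * pderiv i f y = G y := by simp only [G, sq]
      have hGy' : ∑ j, pderiv j f y ^ 2 = G y := rfl
      have hD : ∑ i : Fin n, -2 * (y i - a i) * (-2 * (y i - a i)) =
          4 * ∑ i, (y i - a i) ^ 2 := by
        rw [Finset.mul_sum]; exact Finset.sum_congr rfl fun i _ => by ring
      have hcross : -(2 * (η y * η y) * ∑ i, ∑ j, pderiv i (pderiv j f) y ^ 2) -
          32 * (∑ i, (y i - a i) ^ 2) * G y ≤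
          2 * ∑ i, (-2 * (y i - a i) * η y + η y * (-2 * (y i - a i))) *
            (2 * ∑ j, pderiv i (pderiv j f) y * pderiv j f y) := by
        have hl : -(2 * (η y * η y) * ∑ i, ∑ j, pderiv i (pderiv j f) y ^ 2) -
            32 * (∑ i, (y i - a i) ^ 2) * G y =
            ∑ i, ∑ j, (-2 * (η y * pderiv i (pderiv j f) y) ^ 2 -
              32 * ((y i - a i) * pderiv j f y) ^ 2) := by
          simp only [Finset.sum_sub_distrib, mul_pow, ← Finset.mul_sum, ← Finset.sum_mul, G]
          ring
        rw [hl, Finset.mul_sum]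
        refine Finset.sum_le_sum fun i _ => ?_
        rw [Finset.mul_sum, Finset.mul_sum, Finset.mul_sum]
        refine Finset.sum_le_sum fun j _ => ?_
        linarith [sq_nonneg (η y * pderiv i (pderiv j f) y - 4 * ((y i - a i) * pderiv j f y))]
      simp only [hGy, hGy', hD]
      have h1 : (∑ i, (y i - a i) ^ 2) * G y ≤ r ^ 2 * G y := by gcongr
      have h2 : η y * (n * G y) ≤ r ^ 2 * (n * G y) := by gcongr
      have h3 : 0 ≤ r ^ 2 * G y := by positivity
      simp only [c]
      linarith
    · intro y hy hyn
      rw [hcl] at hy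
      have h1 : ‖y - a‖ = r :=
        le_antisymm (by simpa [dist_eq_norm] using hy) (by simpa [dist_eq_norm] using hyn)
      have h2 : η y = 0 := by simp [η, h1]
      have h3 : c * (f y * f y) ≤ c * S := by
        have := hS y hy
        rw [sq] at this
        gcongr
      simpa [w, h2] using h3
  have hηa : η a = r ^ 2 := by simp [η]
  have h1 : r ^ 2 * r ^ 2 * G a ≤ c * S := by
    refine le_trans ?_ hmax
    have : 0 ≤ c * (f a * f a) := by have := mul_self_nonneg (f a); positivity
    simp only [w, hηa]
    linarith
  rw [le_div_iff₀ (by positivity)]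
  have hr2 : 0 < r ^ 2 := by positivity
  refine le_of_mul_le_mul_left ?_ hr2
  simp only [c, G] at h1
  linarith

end MaximumPrinciple

section Barrier

variable {n : ℕ} {x y : EuclideanSpace ℝ (Fin n)}

/-- The function `|x|^{2-n}`, harmonic away from the origin. -/
def newtonKernel {n : ℕ} (x : EuclideanSpace ℝ (Fin n)) : ℝ :=
  (‖x‖ ^ 2) ^ ((2 - (n : ℝ)) / 2)

lemma newtonKernel_pos (hx : x ≠ 0) : 0 < newtonKernel x :=
  Real.rpow_pos_of_pos (by have := norm_pos_iff.2 hx; positivity) _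

lemma contDiffAt_newtonKernel (hx : x ≠ 0) (k : WithTop ℕ∞) :
    ContDiffAt ℝ k newtonKernel x :=
  (contDiff_norm_sq ℝ).contDiffAt.rpow_const_of_ne (by simpa using hx)

lemma lap_newtonKernel (hx : x ≠ 0) : lap newtonKernel x = 0 := by
  have h0 : 0 < ‖x - 0‖ ^ 2 := by have := norm_pos_iff.2 hx; simpa using by positivity
  have h1 : (newtonKernel : EuclideanSpace ℝ (Fin n) → ℝ) =
      fun y => (‖y - 0‖ ^ 2) ^ ((2 - (n : ℝ)) / 2) := by
    ext y; simp [newtonKernel]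
  rw [h1, lap_rpow (contDiff_norm_sub_sq 0 2).contDiffAt h0, lap_norm_sub_sq]
  simp only [pderiv_norm_sub_sq]
  have h2 : ∑ i, (2 * (x i - (0 : EuclideanSpace ℝ (Fin n)) i)) ^ 2 = 4 * ‖x - 0‖ ^ 2 := by
    rw [EuclideanSpace.norm_sq_eq, Finset.mul_sum]
    refine Finset.sum_congr rfl fun i _ => ?_
    simp
    ring
  have h3 : (‖x - 0‖ ^ 2) ^ ((2 - (n : ℝ)) / 2 - 1) =
      (‖x - 0‖ ^ 2) ^ ((2 - (n : ℝ)) / 2 - 2) * ‖x - 0‖ ^ 2 := by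
    rw [← Real.rpow_add_one h0.ne']; ring_nf
  rw [h2, h3]
  ring

lemma newtonKernel_anti (hn : 3 ≤ n) (hx : x ≠ 0) (h : ‖x‖ ≤ ‖y‖) :
    newtonKernel y ≤ newtonKernel x := by
  have h3 : (3 : ℝ) ≤ n := by exact_mod_cast hn
  have := norm_pos_iff.2 hx
  exact Real.rpow_le_rpow_of_nonpos (by positivity) (by gcongr) (by linarith)

lemma tendsto_newtonKernel (hn : 3 ≤ n) :
    Tendsto newtonKernel (cocompact (EuclideanSpace ℝ (Fin n))) (𝓝 0) := by
  have h3 : (3 : ℝ) ≤ n := by exact_mod_cast hn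
  have h := (tendsto_rpow_neg_atTop (y := ((n : ℝ) - 2) / 2) (by linarith)).comp
    ((tendsto_pow_atTop two_ne_zero).comp
      (tendsto_norm_cocompact_atTop (E := EuclideanSpace ℝ (Fin n))))
  refine h.congr fun x => ?_
  simp only [Function.comp, newtonKernel]
  congr 1
  ring

end Barrier

section Exterior

variable {n : ℕ} {Ω : Set (EuclideanSpace ℝ (Fin n))} {u : EuclideanSpace ℝ (Fin n) → ℝ}
  {x : EuclideanSpace ℝ (Fin n)}

lemma ExteriorSol.contDiffAt (hu : ExteriorSol Ω u) (hx : x ∉ Ω) : ContDiffAt ℝ 3 u x := by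
  obtain ⟨⟨U, hU, hsub, hc⟩, -⟩ := hu
  exact (hc.contDiffAt (hU.mem_nhds (hsub hx))).of_le (WithTop.coe_le_coe.2 (le_top : (3 : ℕ∞) ≤ ⊤))

lemma ExteriorSol.eventually_lap (hu : ExteriorSol Ω u) (hx : x ∉ closure Ω) :
    ∀ᶠ y in 𝓝 x, lap u y = 0 := by
  filter_upwards [isClosed_closure.isOpen_compl.mem_nhds hx] with y hy using hu.2.1 y hy

lemma ExteriorSol.eq_one (hΩ : IsOpen Ω) (hu : ExteriorSol Ω u) (hx : x ∉ Ω)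
    (hx' : x ∈ closure Ω) : u x = 1 :=
  hu.2.2.1 x (by rw [hΩ.frontier_eq]; exact ⟨hx', hx⟩)

/-- Comparison of `u` with multiples of `|x|^{2-n}`. -/
lemma ExteriorSol.comparison (hn : 3 ≤ n) (hΩ : GoodDomain Ω) (hu : ExteriorSol Ω u) {α β : ℝ}
    (h : ∀ y ∈ frontier Ω, α * newtonKernel y + β ≤ 0) (hx : x ∉ closure Ω) :
    α * newtonKernel x + β * u x ≤ 0 := by
  have hne : ∀ y, y ∉ Ω → y ≠ 0 := fun y hy h0 => hy (h0 ▸ hΩ.2.2.2)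
  have hcl : closure (closure Ω)ᶜ ⊆ Ωᶜ :=
    closure_minimal (compl_subset_compl.2 subset_closure) hΩ.1.isClosed_compl
  have hsm : ∀ y, y ∉ Ω → ContDiffAt ℝ 2 (fun y => α * newtonKernel y + β * u y) y :=
    fun y hy => (contDiffAt_const.mul (contDiffAt_newtonKernel (hne y hy) 2)).add
      (contDiffAt_const.mul ((hu.contDiffAt hy).of_le (by norm_num)))
  have hsub : ∀ y, y ∉ closure Ω → y ∉ Ω := fun y hy h => hy (subset_closure h)
  refine nonpos_of_lap_nonneg (w := fun y => α * newtonKernel y + β * u y) (by omega)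
    isClosed_closure.isOpen_compl
    (fun y hy => (hsm y (hcl hy)).continuousAt.continuousWithinAt)
    (fun y hy => hsm y (hsub y hy)) (fun y hy => ?_) (fun y hy hyn => ?_) (fun δ hδ => ?_) hx
  · have h1 := contDiffAt_newtonKernel (hne y (hsub y hy)) 2
    have h2 : ContDiffAt ℝ 2 u y := (hu.contDiffAt (hsub y hy)).of_le (by norm_num)
    rw [lap_add (contDiffAt_const.mul h1) (contDiffAt_const.mul h2), lap_const_mul _ h1,
      lap_const_mul _ h2, lap_newtonKernel (hne y (hsub y hy)), hu.2.1 y hy]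
    simp
  · have hy1 : y ∈ closure Ω := not_not.1 hyn
    simp only [hu.eq_one hΩ.1 (hcl hy) hy1, mul_one]
    exact h y (by rw [hΩ.1.frontier_eq]; exact ⟨hy1, hcl hy⟩)
  · have ht : Tendsto (fun y => α * newtonKernel y + β * u y) (cocompact _) (𝓝 0) := by
      simpa using ((tendsto_newtonKernel hn).const_mul α).add (hu.2.2.2.const_mul β)
    filter_upwards [ht.eventually_le_const hδ] with y hy _ using hy

lemma ExteriorSol.exists_lower_bound (hn : 3 ≤ n) (hΩ : GoodDomain Ω) (hu : ExteriorSol Ω u) :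
    ∃ k > 0, ∀ y, y ∉ closure Ω → k * newtonKernel y ≤ u y := by
  obtain ⟨ρ, hρ, hball⟩ := Metric.isOpen_iff.1 hΩ.1 0 hΩ.2.2.2
  let z : EuclideanSpace ℝ (Fin n) := EuclideanSpace.single ⟨0, by omega⟩ ρ
  have hz : ‖z‖ = ρ := by simp [z, abs_of_pos hρ]
  have hz0 : z ≠ 0 := norm_pos_iff.1 (hz ▸ hρ)
  refine ⟨(newtonKernel z)⁻¹, inv_pos.2 (newtonKernel_pos hz0), fun y hy => ?_⟩
  have h := hu.comparison (α := (newtonKernel z)⁻¹) (β := -1) hn hΩ (fun v hv => ?_) hy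
  · linarith
  · rw [hΩ.1.frontier_eq] at hv
    have h1 : ‖z‖ ≤ ‖v‖ := by
      by_contra! h2
      exact hv.2 (hball (by simpa [hz] using h2))
    have h2 := newtonKernel_anti hn hz0 h1
    have h3 : (newtonKernel z)⁻¹ * newtonKernel v ≤ 1 := by
      rw [inv_mul_le_iff₀ (newtonKernel_pos hz0)]
      simpa using h2
    linarith

lemma ExteriorSol.exists_upper_bound (hn : 3 ≤ n) (hΩ : GoodDomain Ω) (hu : ExteriorSol Ω u) :
    ∃ K > 0, ∀ y, y ∉ closure Ω → u y ≤ K * newtonKernel y := by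
  obtain ⟨ρ, hρ, hbd⟩ := hΩ.2.2.1.closure.exists_pos_norm_le
  let z : EuclideanSpace ℝ (Fin n) := EuclideanSpace.single ⟨0, by omega⟩ ρ
  have hz : ‖z‖ = ρ := by simp [z, abs_of_pos hρ]
  have hz0 : z ≠ 0 := norm_pos_iff.1 (hz ▸ hρ)
  refine ⟨(newtonKernel z)⁻¹, inv_pos.2 (newtonKernel_pos hz0), fun y hy => ?_⟩
  have h := hu.comparison (α := -(newtonKernel z)⁻¹) (β := 1) hn hΩ (fun v hv => ?_) hy
  · linarith
  · rw [hΩ.1.frontier_eq] at hv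
    have hv0 : v ≠ 0 := fun h0 => hv.2 (h0 ▸ hΩ.2.2.2)
    have h2 := newtonKernel_anti hn hv0 ((hbd v hv.1).trans_eq hz.symm)
    have h3 : 1 ≤ (newtonKernel z)⁻¹ * newtonKernel v := by
      rw [le_inv_mul_iff₀ (newtonKernel_pos hz0)]
      simpa using h2
    linarith

lemma ExteriorSol.pos (hn : 3 ≤ n) (hΩ : GoodDomain Ω) (hu : ExteriorSol Ω u) (hx : x ∉ Ω) :
    0 < u x := by
  by_cases hx' : x ∈ closure Ω
  · simp [hu.eq_one hΩ.1 hx hx']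
  · obtain ⟨k, hk, h⟩ := hu.exists_lower_bound hn hΩ
    exact (mul_pos hk (newtonKernel_pos (x := x) fun h0 => hx (h0 ▸ hΩ.2.2.2))).trans_le (h x hx')

/-- Decay of the gradient at infinity. -/
lemma ExteriorSol.eventually_sum_pderiv_sq_le (hn : 3 ≤ n) (hΩ : GoodDomain Ω)
    (hu : ExteriorSol Ω u) :
    ∃ C ≥ 0, ∀ᶠ y in cocompact (EuclideanSpace ℝ (Fin n)),
      ∑ j, pderiv j u y ^ 2 ≤ C * (newtonKernel y ^ 2 / ‖y‖ ^ 2) := by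
  obtain ⟨K, hK, hub⟩ := hu.exists_upper_bound hn hΩ
  obtain ⟨ρ, hρ, hbd⟩ := hΩ.2.2.1.closure.exists_pos_norm_le
  let τ : ℝ := (1 / 4) ^ ((2 - (n : ℝ)) / 2)
  refine ⟨(2 * n + 16) * (K * τ) ^ 2 * 4, by positivity, ?_⟩
  filter_upwards [(tendsto_norm_cocompact_atTop (E := EuclideanSpace ℝ (Fin n))).eventually_gt_atTop
    (2 * ρ)] with y hy
  have hy0 : 0 < ‖y‖ := by linarith
  have hfar : ∀ z ∈ closedBall y (‖y‖ / 2), ‖y‖ / 2 ≤ ‖z‖ := by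
    intro z hz
    have h1 : ‖y - z‖ ≤ ‖y‖ / 2 := by rw [← dist_eq_norm]; rwa [dist_comm]
    have h2 : ‖y‖ ≤ ‖y - z‖ + ‖z‖ := by simpa using norm_add_le (y - z) z
    linarith
  have hout : ∀ z ∈ closedBall y (‖y‖ / 2), z ∉ closure Ω := by
    intro z hz hzc
    have h1 := hbd z hzc
    have h2 := hfar z hz
    linarith
  have hout' : ∀ z ∈ closedBall y (‖y‖ / 2), z ∉ Ω := fun z hz h =>
    hout z hz (subset_closure h)
  have hhalf : newtonKernel ((1 / 2 : ℝ) • y) = τ * newtonKernel y := by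
    simp only [newtonKernel, norm_smul, τ, mul_pow]
    rw [Real.mul_rpow (by positivity) (by positivity)]
    norm_num
  have hS : ∀ z ∈ closedBall y (‖y‖ / 2), u z ^ 2 ≤ (K * (τ * newtonKernel y)) ^ 2 := by
    intro z hz
    have h1 : newtonKernel z ≤ τ * newtonKernel y := by
      rw [← hhalf]
      refine newtonKernel_anti hn (by simpa using hy0) ?_
      have := hfar z hz
      rw [norm_smul]
      norm_num
      linarith
    refine pow_le_pow_left₀ (hu.pos hn hΩ (hout' z hz)).le ((hub z (hout z hz)).trans ?_) 2
    gcongr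
  refine (sum_pderiv_sq_le_of_harmonic (by omega) (by positivity)
    (fun z hz => hu.contDiffAt (hout' z hz))
    (fun z hz => hu.2.1 z (hout z (ball_subset_closedBall hz))) hS).trans_eq ?_
  field_simp
  ring

lemma ExteriorSol.eventually_sum_pderiv_sq_mul_rpow_le (hn : 3 ≤ n) (hΩ : GoodDomain Ω) (hu : ExteriorSol Ω u)
    {δ : ℝ} (hδ : 0 < δ) : ∀ᶠ y in cocompact (EuclideanSpace ℝ (Fin n)),
      (∑ j, pderiv j u y ^ 2) * u y ^ (-((n : ℝ) / (n - 2))) ≤ δ := by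
  have h3 : (3 : ℝ) ≤ n := by exact_mod_cast hn
  have hn2 : 0 < (n : ℝ) - 2 := by linarith
  obtain ⟨C, hC, hgrad⟩ := hu.eventually_sum_pderiv_sq_le hn hΩ
  obtain ⟨k, hk, hlb⟩ := hu.exists_lower_bound hn hΩ
  set p : ℝ := (n : ℝ) / (n - 2) with hp
  have ht : Tendsto (fun y => C * k ^ (-p) * newtonKernel y)
      (cocompact (EuclideanSpace ℝ (Fin n))) (𝓝 0) := by
    simpa using (tendsto_newtonKernel hn).const_mul (C * k ^ (-p))
  filter_upwards [hgrad, ht.eventually_le_const hδ,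
    hΩ.2.2.1.isCompact_closure.compl_mem_cocompact] with y h1 h2 hy
  have hyΩ : y ∉ Ω := fun h => hy (subset_closure h)
  have hy0 : y ≠ 0 := fun h0 => hyΩ (h0 ▸ hΩ.2.2.2)
  have hN := newtonKernel_pos hy0
  have hsq : 0 < ‖y‖ ^ 2 := by have := norm_pos_iff.2 hy0; positivity
  have hrp : u y ^ (-p) ≤ (k * newtonKernel y) ^ (-p) :=
    Real.rpow_le_rpow_of_nonpos (by positivity) (hlb y hy) (by rw [hp, neg_nonpos]; positivity)
  have hid : newtonKernel y ^ 2 / ‖y‖ ^ 2 * newtonKernel y ^ (-p) = newtonKernel y := by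
    simp only [newtonKernel]
    rw [← Real.rpow_natCast ((‖y‖ ^ 2) ^ ((2 - (n : ℝ)) / 2)), ← Real.rpow_mul hsq.le,
      ← Real.rpow_mul hsq.le, ← Real.rpow_sub_one hsq.ne', ← Real.rpow_add hsq]
    congr 1
    rw [hp]
    field_simp
    push_cast
    ring
  refine le_trans ?_ h2
  calc (∑ j, pderiv j u y ^ 2) * u y ^ (-p)
      ≤ C * (newtonKernel y ^ 2 / ‖y‖ ^ 2) * (k * newtonKernel y) ^ (-p) := by
        gcongr
        exact Real.rpow_nonneg (hu.pos hn hΩ hyΩ).le _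
    _ = C * k ^ (-p) * (newtonKernel y ^ 2 / ‖y‖ ^ 2 * newtonKernel y ^ (-p)) := by
        rw [Real.mul_rpow hk.le hN.le]; ring
    _ = C * k ^ (-p) * newtonKernel y := by rw [hid]

lemma ExteriorSol.exists_eq (hn : 3 ≤ n) (hΩ : GoodDomain Ω) (hu : ExteriorSol Ω u) {c : ℝ}
    (hc : 0 < c) (hc1 : c ≤ 1) : ∃ y, y ∉ Ω ∧ u y = c := by
  let e : EuclideanSpace ℝ (Fin n) := EuclideanSpace.single ⟨0, by omega⟩ 1
  have he : ‖e‖ = 1 := by simp [e]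
  have hline : Continuous fun t : ℝ => t • e := by fun_prop
  have hnorm : ∀ t : ℝ, ‖t • e‖ = |t| := fun t => by rw [norm_smul, he, mul_one, Real.norm_eq_abs]
  obtain ⟨B, hB⟩ := hΩ.2.2.1.closure.exists_norm_le
  let A : Set ℝ := {t | t • e ∈ closure Ω}
  have hA : IsCompact A := by
    refine Metric.isCompact_of_isClosed_isBounded (isClosed_closure.preimage hline) ?_
    refine isBounded_iff_forall_norm_le.2 ⟨B, fun t ht => ?_⟩
    rw [Real.norm_eq_abs, ← hnorm]
    exact hB _ ht
  obtain ⟨t₀, ht₀, hmax⟩ := hA.exists_isGreatest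
    ⟨0, subset_closure (by simpa using hΩ.2.2.2)⟩
  have hout : ∀ t, t₀ < t → t • e ∉ closure Ω := fun t ht h => (hmax h).not_gt ht
  have hout₀ : t₀ • e ∉ Ω := by
    intro h
    have hev : ∀ᶠ t in 𝓝[>] t₀, t • e ∈ Ω :=
      (hline.continuousAt.eventually (hΩ.1.mem_nhds h)).filter_mono nhdsWithin_le_nhds
    obtain ⟨t, ht, htt⟩ := (hev.and self_mem_nhdsWithin).exists
    exact hout t htt (subset_closure ht)
  have hnot : ∀ t, t₀ ≤ t → t • e ∉ Ω := fun t ht h => by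
    rcases ht.eq_or_lt with rfl | hlt
    · exact hout₀ h
    · exact hout t hlt (subset_closure h)
  have htend : Tendsto (fun t : ℝ => u (t • e)) atTop (𝓝 0) := by
    refine hu.2.2.2.comp ?_
    rw [← cobounded_eq_cocompact, ← tendsto_norm_atTop_iff_cobounded]
    simp only [hnorm]
    exact tendsto_abs_atTop_atTop
  obtain ⟨T, hT, hTt⟩ := ((htend.eventually_lt_const hc).and (eventually_ge_atTop t₀)).exists
  have hcont : ContinuousOn (fun t : ℝ => u (t • e)) (Icc t₀ T) := fun t ht =>
    (ContinuousAt.comp (g := u) (f := fun t : ℝ => t • e)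
      (hu.contDiffAt (hnot t ht.1)).continuousAt hline.continuousAt).continuousWithinAt
  obtain ⟨t, ht, htc⟩ := intermediate_value_Icc' hTt hcont
    ⟨hT.le, by simpa [hu.eq_one hΩ.1 hout₀ ht₀] using hc1⟩
  exact ⟨t • e, hnot t ht.1, htc⟩

lemma ExteriorSol.isCompact_level (hΩ : GoodDomain Ω) (hu : ExteriorSol Ω u) {c : ℝ}
    (hc : 0 < c) : IsCompact {y | y ∉ Ω ∧ u y = c} := by
  have hcont : ContinuousOn u Ωᶜ := fun y hy =>
    (hu.contDiffAt hy).continuousAt.continuousWithinAt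
  obtain ⟨t, ht, hsub⟩ := mem_cocompact.1 (hu.2.2.2.eventually_lt_const hc)
  refine ht.of_isClosed_subset
    (hcont.preimage_isClosed_of_isClosed hΩ.1.isClosed_compl isClosed_singleton (t := {c}))
    fun y hy => ?_
  by_contra hyt
  exact (hsub hyt).ne hy.2

lemma Pfun_eq (u : EuclideanSpace ℝ (Fin n) → ℝ) (x : EuclideanSpace ℝ (Fin n)) :
    Pfun u x = (∑ j, pderiv j u x ^ 2) / u x ^ (2 * ((n : ℝ) - 1) / ((n : ℝ) - 2)) := by
  rw [Pfun, norm_gradient_sq]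

lemma sum_pderiv_sq_mul_rpow_eq (hn : 3 ≤ n) (hx : 0 < u x) :
    (∑ j, pderiv j u x ^ 2) * u x ^ (-((n : ℝ) / (n - 2))) = Pfun u x * u x := by
  have h3 : (3 : ℝ) ≤ n := by exact_mod_cast hn
  have hn2 : (n : ℝ) - 2 ≠ 0 := by linarith
  have h : u x ^ (-((n : ℝ) / (n - 2))) =
      (u x ^ (2 * ((n : ℝ) - 1) / ((n : ℝ) - 2)))⁻¹ * u x := by
    rw [← Real.rpow_neg hx.le, ← Real.rpow_add_one hx.ne']
    congr 1
    field_simp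
    ring
  rw [Pfun_eq, h]
  ring

lemma ExteriorSol.continuousAt_Pfun (hn : 3 ≤ n) (hΩ : GoodDomain Ω) (hu : ExteriorSol Ω u)
    (hx : x ∉ Ω) : ContinuousAt (Pfun u) x := by
  have hpos := hu.pos hn hΩ hx
  have h := hu.contDiffAt hx
  rw [show Pfun u = fun y => _ from funext (Pfun_eq u)]
  exact (contDiffAt_sum_pderiv_sq h).continuousAt.div
    (h.continuousAt.rpow_const (Or.inl hpos.ne')) (Real.rpow_pos_of_pos hpos _).ne'

end Exterior

/-- the `P`-function of the exterior potential attains, on every level set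
`{u = c}`, its supremum over the sublevel set `{u ≤ c}`. -/
theorem exterior_P_function_max_on_level
    (n : ℕ) (hn : 3 ≤ n) (Ω : Set (EuclideanSpace ℝ (Fin n)))
    (u : EuclideanSpace ℝ (Fin n) → ℝ)
    (hΩ : GoodDomain Ω) (hu : ExteriorSol Ω u) :
    ∀ c : ℝ, 0 < c → c ≤ 1 →
      ∃ x₀, (x₀ ∉ Ω ∧ u x₀ = c) ∧ ∀ x, x ∉ Ω → u x ≤ c → Pfun u x ≤ Pfun u x₀ := by
  intro c hc hc1
  obtain ⟨x₀, hx₀, hmax⟩ := (hu.isCompact_level hΩ hc).exists_isMaxOn (hu.exists_eq hn hΩ hc hc1)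
    fun y hy => (hu.continuousAt_Pfun hn hΩ hy.1).continuousWithinAt
  refine ⟨x₀, hx₀, fun x hx hxc => ?_⟩
  rcases hxc.eq_or_lt with heq | hlt
  · exact hmax ⟨hx, heq⟩
  set M := Pfun u x₀ with hM
  have hM0 : 0 ≤ M := div_nonneg (sq_nonneg _) (Real.rpow_nonneg (hx₀.2 ▸ hc.le) _)
  let Q : EuclideanSpace ℝ (Fin n) → ℝ := fun y =>
    (∑ j, pderiv j u y ^ 2) * u y ^ (-((n : ℝ) / (n - 2)))
  let D : Set (EuclideanSpace ℝ (Fin n)) := (closure Ω)ᶜ ∩ u ⁻¹' Iio c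
  have hcont : ContinuousOn u Ωᶜ := fun y hy =>
    (hu.contDiffAt hy).continuousAt.continuousWithinAt
  have hsub : (closure Ω)ᶜ ⊆ Ωᶜ := compl_subset_compl.2 subset_closure
  have hD : IsOpen D :=
    (hcont.mono hsub).isOpen_inter_preimage isClosed_closure.isOpen_compl isOpen_Iio
  have hclD : closure D ⊆ Ωᶜ ∩ u ⁻¹' Iic c :=
    closure_minimal (fun y hy => ⟨hsub hy.1, show u y ≤ c from le_of_lt hy.2⟩)
      (hcont.preimage_isClosed_of_isClosed hΩ.1.isClosed_compl isClosed_Iic)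
  have hpos : ∀ y, y ∉ Ω → 0 < u y := fun y hy => hu.pos hn hΩ hy
  have hQ : ∀ y, y ∉ Ω → ContDiffAt ℝ 2 Q y := fun y hy =>
    (contDiffAt_sum_pderiv_sq (hu.contDiffAt hy)).mul
      (((hu.contDiffAt hy).of_le (by norm_num)).rpow_const_of_ne (hpos y hy).ne')
  have hu2 : ∀ y, y ∉ Ω → ContDiffAt ℝ 2 u y := fun y hy =>
    (hu.contDiffAt hy).of_le (by norm_num)
  have hw : ∀ y, y ∉ Ω → ContDiffAt ℝ 2 (fun y => Q y + -M * u y) y := fun y hy =>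
    (hQ y hy).add (contDiffAt_const.mul (hu2 y hy))
  have hxD : x ∈ D := by
    refine ⟨fun hxc => ?_, hlt⟩
    rw [hu.eq_one hΩ.1 hx hxc] at hlt
    exact hlt.not_ge hc1
  have key := nonpos_of_lap_nonneg (w := fun y => Q y + -M * u y) (by omega) hD
    (fun y hy => (hw y (hclD hy).1).continuousAt.continuousWithinAt)
    (fun y hy => hw y (hsub hy.1)) (fun y hy => ?_) (fun y hy hyn => ?_) (fun δ hδ => ?_) hxD
  · simp only [Q, sum_pderiv_sq_mul_rpow_eq hn (hpos x hx)] at key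
    exact le_of_mul_le_mul_right (by linarith) (hpos x hx)
  · have hyΩ := hsub hy.1
    rw [lap_add (hQ y hyΩ) (contDiffAt_const.mul (hu2 y hyΩ)), lap_const_mul _ (hu2 y hyΩ),
      hu.2.1 y hy.1, mul_zero, add_zero]
    exact lap_sum_pderiv_sq_mul_rpow_nonneg hn (hu.contDiffAt hyΩ) (hu.eventually_lap hy.1)
      (hpos y hyΩ)
  · obtain ⟨hyΩ, hyc⟩ := hclD hy
    have heq : u y = c := by
      refine le_antisymm hyc (le_of_not_gt fun hlt' => ?_)
      by_cases hyc' : y ∈ closure Ω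
      · rw [hu.eq_one hΩ.1 hyΩ hyc'] at hlt'
        exact hlt'.not_ge hc1
      · exact hyn ⟨hyc', hlt'⟩
    have h1 : Pfun u y ≤ M := hmax ⟨hyΩ, heq⟩
    have h2 := mul_le_mul_of_nonneg_right h1 (hpos y hyΩ).le
    simp only [Q, sum_pderiv_sq_mul_rpow_eq hn (hpos y hyΩ)]
    linarith
  · filter_upwards [hu.eventually_sum_pderiv_sq_mul_rpow_le hn hΩ hδ] with y hy hyD
    have h1 := mul_nonneg hM0 (hpos y (hclD hyD).1).le
    simp only [Q]
    linarith
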